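/- Let P be a simple polygon and W a witness set of P; assume Vis(u) equals the closure of its interior for every u ∈ W. If v, w ∈ W are adjacent in the neighbor witness graph GCon(W), then there exists exactly one connected component of NVis(W) that is attached to both Vis(v) and Vis(w). -/

import Mathlib

open Set

noncomputable section

abbrev Plane := EuclideanSpace ℝ (Fin 2)

/-- A simple polygon, given by a cyclic sequence of at least three distinct vertices
whose closed polygonal boundary curve is a Jordan polygon: two edges intersect exactly
when they are consecutive, and then only in their one shared endpoint. -/
structure SimplePolygon where
  n : ℕ
  three_le : 3 ≤ n
  vertex : ℕ → Plane
  periodic : ∀ i, vertex (i + n) = vertex i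
  inj : ∀ i < n, ∀ j < n, vertex i = vertex j → i = j
  jordan : ∀ i < n, ∀ j < n, i ≠ j →
    segment ℝ (vertex i) (vertex (i + 1)) ∩ segment ℝ (vertex j) (vertex (j + 1)) =
      if j = (i + 1) % n then {vertex (i + 1)}
      else if i = (j + 1) % n then {vertex (j + 1)}
      else ∅

namespace SimplePolygon

/-- The boundary curve of the polygon: the union of its edges. -/
def boundary (P : SimplePolygon) : Set Plane :=
  ⋃ i ∈ Finset.range P.n, segment ℝ (P.vertex i) (P.vertex (i + 1))

/-- The polygon as a region: the boundary together with all bounded connected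
components of the complement of the boundary. -/
def region (P : SimplePolygon) : Set Plane :=
  P.boundary ∪ {x | x ∉ P.boundary ∧
    Bornology.IsBounded (connectedComponentIn P.boundaryᶜ x)}

/-- Visibility region of a point `p`: all points `q` of the polygon such that the
closed segment `[p,q]` is contained in the polygon. -/
def Vis (P : SimplePolygon) (p : Plane) : Set Plane :=
  {q | q ∈ P.region ∧ segment ℝ p q ⊆ P.region}

/-- Visibility region of a set. -/
def VisSet (P : SimplePolygon) (S : Set Plane) : Set Plane :=
  ⋃ p ∈ S, P.Vis p

/-- Two points of the polygon are visible to each other if the segment joining them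
lies in the polygon. -/
def Visible (P : SimplePolygon) (p q : Plane) : Prop :=
  p ∈ P.region ∧ q ∈ P.region ∧ segment ℝ p q ⊆ P.region

/-- A witness set: a finite set of points of the polygon with pairwise disjoint
visibility regions. -/
def IsWitnessSet (P : SimplePolygon) (W : Set Plane) : Prop :=
  W.Finite ∧ W ⊆ P.region ∧
    ∀ x ∈ W, ∀ y ∈ W, x ≠ y → P.Vis x ∩ P.Vis y = ∅

/-- The non-visible region of a witness set. -/
def NVis (P : SimplePolygon) (W : Set Plane) : Set Plane :=
  P.region \ ⋃ w ∈ W, P.Vis w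

/-- `Vis p` is regular (has no arms) if it equals the closure of its interior. -/
def VisRegular (P : SimplePolygon) (p : Plane) : Prop :=
  P.Vis p = closure (interior (P.Vis p))

/-- A window of `Vis p`: a non-degenerate closed segment contained in the frontier of
`Vis p` whose intersection with the frontier of the polygon is exactly its two
endpoints, maximal with these properties. -/
def IsWindow (P : SimplePolygon) (p : Plane) (e : Set Plane) : Prop :=
  ∃ a b : Plane, a ≠ b ∧ e = segment ℝ a b ∧
    e ⊆ frontier (P.Vis p) ∧
    e ∩ frontier P.region = {a, b} ∧
    ∀ a' b' : Plane, a' ≠ b' →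
      segment ℝ a' b' ⊆ frontier (P.Vis p) →
      segment ℝ a' b' ∩ frontier P.region = {a', b'} →
      e ⊆ segment ℝ a' b' → e = segment ℝ a' b'

/-- `γ` is (the image of) a neighbor witness path between `w` and `w'`. -/
def IsNWPath (P : SimplePolygon) (W : Set Plane) (w w' : Plane) (γ : Set Plane) : Prop :=
  ∃ f : Path w w', γ = Set.range f ∧ γ ⊆ P.Vis w ∪ P.NVis W ∪ P.Vis w'

/-- Adjacency in the neighbor witness graph `GCon(W)`. -/
def GConAdj (P : SimplePolygon) (W : Set Plane) (w w' : Plane) : Prop :=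
  w ∈ W ∧ w' ∈ W ∧ w ≠ w' ∧ ∃ γ : Set Plane, P.IsNWPath W w w' γ

/-- A connected component `NV` of `NVis W` is attached to `Vis w` if the closure of
`NV` intersects `Vis w`. -/
def Attached (P : SimplePolygon) (NV : Set Plane) (w : Plane) : Prop :=
  (closure NV ∩ P.Vis w).Nonempty

/-- `w` is a simplicial vertex of `GCon(W)`: its neighbors are pairwise adjacent. -/
def Simplicial (P : SimplePolygon) (W : Set Plane) (w : Plane) : Prop :=
  ∀ u v : Plane, P.GConAdj W w u → P.GConAdj W w v → u ≠ v → P.GConAdj W u v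

end SimplePolygon

/-- `NV` is a connected component of `S`. -/
def IsCompOf (NV S : Set Plane) : Prop :=
  ∃ x ∈ S, NV = connectedComponentIn S x

/-- The function `f` admits a continuous complex logarithm on `s`. -/
def HasLogOn {X : Type*} [TopologicalSpace X] (f : X → ℂ) (s : Set X) : Prop :=
  ∃ g : X → ℂ, ContinuousOn g s ∧ ∀ z ∈ s, Complex.exp (g z) = f z

theorem eqOn_of_exp_eq {X : Type*} [TopologicalSpace X] {s : Set X} (hs : IsPreconnected s)
    {g₁ g₂ : X → ℂ} (h₁ : ContinuousOn g₁ s) (h₂ : ContinuousOn g₂ s)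
    (h : ∀ z ∈ s, Complex.exp (g₁ z) = Complex.exp (g₂ z)) {x : X} (hx : x ∈ s)
    (hgx : g₁ x = g₂ x) : EqOn g₁ g₂ s := by
  have hre : ∀ z ∈ s, (g₁ z).re = (g₂ z).re := by
    intro z hz
    have := congrArg norm (h z hz)
    rwa [Complex.norm_exp, Complex.norm_exp, Real.exp_eq_exp] at this
  have him : EqOn (fun z => (g₁ z).im) (fun z => (g₂ z).im) s := by
    refine Circle.isCoveringMap_exp.eqOn_of_comp_eqOn hs
      (Complex.continuous_im.comp_continuousOn h₁)
      (Complex.continuous_im.comp_continuousOn h₂) ?_ hx (by simp [hgx])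
    intro z hz
    have h3 := h z hz
    rw [Complex.exp_eq_exp_re_mul_sin_add_cos, Complex.exp_eq_exp_re_mul_sin_add_cos (g₂ z),
      hre z hz] at h3
    have h4 := mul_left_cancel₀ (Complex.exp_ne_zero _) h3
    ext
    simp only [Function.comp, Circle.coe_exp, Complex.exp_mul_I]
    exact h4
  intro z hz
  exact Complex.ext (hre z hz) (him hz)

theorem HasLogOn.union {X : Type*} [TopologicalSpace X] {f : X → ℂ} {s t : Set X}
    (hs : IsClosed s) (ht : IsClosed t) (hst : IsPreconnected (s ∩ t))
    (hfs : HasLogOn f s) (hft : HasLogOn f t) : HasLogOn f (s ∪ t) := by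
  classical
  obtain ⟨g₁, hg₁, he₁⟩ := hfs
  obtain ⟨g₂, hg₂, he₂⟩ := hft
  obtain ⟨c, hc, hcs⟩ : ∃ c : ℂ, (∀ z ∈ t, Complex.exp (g₂ z + c) = f z) ∧
      ∀ z ∈ s ∩ t, g₁ z = g₂ z + c := by
    rcases (s ∩ t).eq_empty_or_nonempty with h | ⟨x, hx⟩
    · exact ⟨0, by simpa using he₂, by simp [h]⟩
    · have h1 : Complex.exp (g₁ x - g₂ x) = 1 := by
        rw [Complex.exp_sub, he₁ x hx.1, he₂ x hx.2, div_self]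
        rw [← he₁ x hx.1]; exact Complex.exp_ne_zero _
      have h2 : ∀ z ∈ t, Complex.exp (g₂ z + (g₁ x - g₂ x)) = f z := by
        intro z hz
        rw [Complex.exp_add, h1, mul_one, he₂ z hz]
      refine ⟨g₁ x - g₂ x, h2, eqOn_of_exp_eq hst (hg₁.mono inter_subset_left)
        ((hg₂.mono inter_subset_right).add continuousOn_const) ?_ hx (by ring)⟩
      intro z hz
      rw [he₁ z hz.1, h2 z hz.2]
  have hs' : EqOn (s.piecewise g₁ fun z => g₂ z + c) g₁ s := fun z hz => by simp [hz]
  have ht' : EqOn (s.piecewise g₁ fun z => g₂ z + c) (fun z => g₂ z + c) t := by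
    intro z hz
    by_cases h : z ∈ s
    · simp [h, hcs z ⟨h, hz⟩]
    · simp [h]
  refine ⟨s.piecewise g₁ fun z => g₂ z + c, ?_, ?_⟩
  · exact (hg₁.congr hs').union_of_isClosed ((hg₂.add continuousOn_const).congr ht') hs ht
  · rintro z (hz | hz)
    · rw [hs' hz, he₁ z hz]
    · rw [ht' hz, hc z hz]

theorem exists_continuous_log {f : Plane → ℂ} (hf : Continuous f) (h0 : ∀ z, f z ≠ 0) :
    ∃ g : Plane → ℂ, Continuous g ∧ ∀ z, Complex.exp (g z) = f z := by
  have hn : ∀ z, f z / (‖f z‖ : ℂ) ∈ Submonoid.unitSphere ℂ := fun z => by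
    have := norm_ne_zero_iff.2 (h0 z)
    exact mem_sphere_zero_iff_norm.2 (by simp [this])
  let u : C(Plane, Circle) := ⟨fun z => ⟨f z / (‖f z‖ : ℂ), hn z⟩, by
    refine Continuous.subtype_mk (hf.div (by fun_prop) fun z => ?_) _
    simpa using h0 z⟩
  obtain ⟨θ₀, hθ₀⟩ := Circle.exp_surjective (u 0)
  obtain ⟨F, ⟨-, hF⟩, -⟩ := Circle.isCoveringMap_exp.existsUnique_continuousMap_lifts u 0 θ₀ hθ₀
  refine ⟨fun z => (Real.log ‖f z‖ : ℂ) + F z * Complex.I, ?_, fun z => ?_⟩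
  · have : Continuous fun z => Real.log ‖f z‖ :=
      hf.norm.log fun z => norm_ne_zero_iff.2 (h0 z)
    fun_prop
  · have h1 : Complex.exp (F z * Complex.I) = f z / (‖f z‖ : ℂ) := by
      rw [← Circle.coe_exp]
      exact congrArg Subtype.val (congrFun hF z)
    have h2 : (‖f z‖ : ℂ) ≠ 0 := by simpa using h0 z
    rw [Complex.exp_add, h1, ← Complex.ofReal_exp, Real.exp_log (norm_pos_iff.2 (h0 z))]
    field_simp

/-- The standard linear isometry between the Euclidean plane and `ℂ`. -/
def planeToComplex : Plane ≃ₗᵢ[ℝ] ℂ := Complex.orthonormalBasisOneI.repr.symm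

theorem not_exists_log_sub (p : Plane) (R : ℝ) {G : Plane → ℂ} (hG : Continuous G) :
    ¬ ∀ z, R ≤ ‖z‖ → Complex.exp (G z) = planeToComplex z - planeToComplex p := by
  intro h
  let r : ℝ := |R| + ‖p‖ + 1
  have hr0 : 0 < r := by positivity
  let c : ℝ → Plane := fun θ =>
    planeToComplex.symm (planeToComplex p + r * Complex.exp (θ * Complex.I))
  have hc : Continuous c := planeToComplex.symm.continuous.comp (by fun_prop)
  have hcn : ∀ θ, R ≤ ‖c θ‖ := by
    intro θ
    rw [LinearIsometryEquiv.norm_map]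
    have h1 := norm_sub_le (planeToComplex p + r * Complex.exp (θ * Complex.I)) (planeToComplex p)
    rw [add_sub_cancel_left, norm_mul, Complex.norm_exp_ofReal_mul_I, LinearIsometryEquiv.norm_map,
      Complex.norm_real, Real.norm_eq_abs, abs_of_pos hr0] at h1
    have := le_abs_self R
    simp only [r] at h1
    linarith
  have hexp : ∀ θ : ℝ, Complex.exp (G (c θ)) = r * Complex.exp (θ * Complex.I) := by
    intro θ
    rw [h _ (hcn θ)]
    simp [c]
  have key := eqOn_of_exp_eq (isPreconnected_univ (α := ℝ)) (g₁ := fun θ => G (c θ))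
    (g₂ := fun θ => G (c 0) + θ * Complex.I) (hG.comp hc).continuousOn
    (by fun_prop) (fun θ _ => by
      rw [Complex.exp_add, hexp, hexp]; simp) (mem_univ 0) (by simp)
  have h2 := key (mem_univ (2 * Real.pi))
  have h3 : c (2 * Real.pi) = c 0 := by simp [c]
  simp [h3, Real.pi_ne_zero] at h2

theorem hasLogOn_div_of_isPreconnected {X T : Set Plane} (hX : IsClosed X)
    (hT : IsPreconnected T) (hTX : Disjoint T X) {p q : Plane} (hp : p ∈ T) (hq : q ∈ T) :
    HasLogOn (fun z => (planeToComplex z - planeToComplex p) /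
      (planeToComplex z - planeToComplex q)) X := by
  have hne : ∀ a ∈ T, ∀ z ∈ X, planeToComplex z - planeToComplex a ≠ 0 := by
    intro a ha z hz h
    have := planeToComplex.injective (sub_eq_zero.1 h)
    exact disjoint_left.1 hTX ha (this ▸ hz)
  let Q : Plane → Plane → Prop := fun a b => a ∈ T → b ∈ T →
    HasLogOn (fun z => (planeToComplex z - planeToComplex a) /
      (planeToComplex z - planeToComplex b)) X
  suffices Q p q from this hp hq
  refine hT.induction₂ Q ?_ ?_ ?_ hp hq
  · intro a ha
    have haX : a ∈ Xᶜ := disjoint_left.1 hTX ha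
    obtain ⟨r, hr, hball⟩ := Metric.isOpen_iff.1 hX.isOpen_compl a haX
    filter_upwards [mem_nhdsWithin_of_mem_nhds (Metric.ball_mem_nhds a hr)] with b hb _ hbT
    have hlt : ∀ z ∈ X, ‖planeToComplex b - planeToComplex a‖ <
        ‖planeToComplex z - planeToComplex a‖ := by
      intro z hz
      rw [← map_sub, ← map_sub, LinearIsometryEquiv.norm_map, LinearIsometryEquiv.norm_map,
        ← dist_eq_norm, ← dist_eq_norm]
      have : ¬ dist z a < r := fun h => hball h hz
      have := Metric.mem_ball.1 hb
      linarith
    have hslit : ∀ z ∈ X, (planeToComplex z - planeToComplex b) /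
        (planeToComplex z - planeToComplex a) ∈ Complex.slitPlane := by
      intro z hz
      have h0 := hne a ha z hz
      have : (planeToComplex z - planeToComplex b) / (planeToComplex z - planeToComplex a) =
          1 + -((planeToComplex b - planeToComplex a) /
            (planeToComplex z - planeToComplex a)) := by
        field_simp; ring
      rw [this]
      apply Complex.mem_slitPlane_of_norm_lt_one
      rw [norm_neg, norm_div, div_lt_one (norm_pos_iff.2 h0)]
      exact hlt z hz
    refine ⟨fun z => -Complex.log ((planeToComplex z - planeToComplex b) /
        (planeToComplex z - planeToComplex a)), ?_, ?_⟩
    · refine (ContinuousOn.clog ?_ hslit).neg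
      exact ContinuousOn.div (by fun_prop) (by fun_prop) (hne a ha)
    · intro z hz
      rw [Complex.exp_neg, Complex.exp_log (Complex.slitPlane_ne_zero (hslit z hz)), inv_div]
  · intro a b d ha hb hd hab hbd ha' hd'
    obtain ⟨g₁, hg₁, h₁⟩ := hab ha hb
    obtain ⟨g₂, hg₂, h₂⟩ := hbd hb hd
    refine ⟨fun z => g₁ z + g₂ z, hg₁.add hg₂, fun z hz => ?_⟩
    rw [Complex.exp_add, h₁ z hz, h₂ z hz, div_mul_div_cancel₀ (hne b hb z hz)]
  · intro a b ha hb hab hb' ha'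
    obtain ⟨g₁, hg₁, h₁⟩ := hab ha hb
    refine ⟨fun z => - g₁ z, hg₁.neg, fun z hz => ?_⟩
    rw [Complex.exp_neg, h₁ z hz, inv_div]

theorem not_hasLogOn_div_of_separated {X U V : Set Plane} (hX : IsClosed X) (hU : IsOpen U)
    (hV : IsOpen V) (hUV : Disjoint U V) (hcover : Xᶜ ⊆ U ∪ V) {R : ℝ}
    (hR : ∀ z, R ≤ ‖z‖ → z ∈ X) {p q : Plane} (hp : p ∈ U \ X) (hq : q ∈ V \ X) :
    ¬ HasLogOn (fun z => (planeToComplex z - planeToComplex p) /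
      (planeToComplex z - planeToComplex q)) X := by
  classical
  rintro ⟨g, hg, hexp⟩
  obtain ⟨G, hG⟩ := ContinuousMap.exists_restrict_eq hX ⟨X.domRestrict g, hg.domRestrict⟩
  have hGg : ∀ z ∈ X, G z = g z := fun z hz => congrArg (fun k => k ⟨z, hz⟩) hG
  have hne : ∀ {a z : Plane}, z ≠ a → planeToComplex z - planeToComplex a ≠ 0 :=
    fun h h' => h (planeToComplex.injective (sub_eq_zero.1 h'))
  have hA : IsClosed (Uᶜ ∪ X) := hU.isClosed_compl.union hX
  have hB : IsClosed (Vᶜ ∪ X) := hV.isClosed_compl.union hX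
  let H : Plane → ℂ := (Uᶜ ∪ X).piecewise (fun z => planeToComplex z - planeToComplex p)
    (fun z => (planeToComplex z - planeToComplex q) * Complex.exp (G z))
  have hHA : EqOn H (fun z => planeToComplex z - planeToComplex p) (Uᶜ ∪ X) :=
    fun z hz => piecewise_eq_of_mem _ _ _ hz
  have hHB : EqOn H (fun z => (planeToComplex z - planeToComplex q) * Complex.exp (G z))
      (Vᶜ ∪ X) := by
    intro z hz
    by_cases hzX : z ∈ X
    · have hzq : z ≠ q := fun h => hq.2 (h ▸ hzX)
      have h0 := hne hzq
      rw [hHA (Or.inr hzX)]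
      simp only
      rw [hGg z hzX, hexp z hzX]
      field_simp
    · have hzV : z ∉ V := hz.resolve_right hzX
      have hzU : z ∈ U := (hcover hzX).resolve_right hzV
      exact piecewise_eq_of_notMem _ _ _ (by simp [hzX, hzU])
  have hcov : (Uᶜ ∪ X) ∪ (Vᶜ ∪ X) = univ := by
    refine eq_univ_of_forall fun z => ?_
    by_cases hzU : z ∈ U
    · exact Or.inr (Or.inl (disjoint_left.1 hUV hzU))
    · exact Or.inl (Or.inl hzU)
  have hHc : Continuous H := by
    rw [← continuousOn_univ, ← hcov]
    refine ContinuousOn.union_of_isClosed ?_ ?_ hA hB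
    · exact ContinuousOn.congr (by fun_prop) hHA
    · exact ContinuousOn.congr (by fun_prop) hHB
  have hH0 : ∀ z, H z ≠ 0 := by
    intro z
    by_cases hz : z ∈ Uᶜ ∪ X
    · rw [hHA hz]
      refine hne fun h => ?_
      subst h
      exact hz.elim (fun h => h hp.1) hp.2
    · have hzB : z ∈ Vᶜ ∪ X := by
        have : z ∈ (Uᶜ ∪ X) ∪ (Vᶜ ∪ X) := hcov ▸ mem_univ z
        exact this.resolve_left hz
      rw [hHB hzB]
      refine mul_ne_zero (hne fun h => ?_) (Complex.exp_ne_zero _)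
      subst h
      exact hzB.elim (fun h => h hq.1) hq.2
  obtain ⟨L, hL, hLe⟩ := exists_continuous_log hHc hH0
  refine not_exists_log_sub p R hL fun z hz => ?_
  rw [hLe, hHA (Or.inr (hR z hz))]

theorem isPreconnected_setOf_le_norm {R : ℝ} (hR : 0 < R) :
    IsPreconnected {z : Plane | R ≤ ‖z‖} := by
  have hrank : 1 < Module.rank ℝ Plane := by
    rw [← Module.finrank_eq_rank, finrank_euclideanSpace_fin]
    norm_num
  have h : {z : Plane | R ≤ ‖z‖} =
      (fun c : ℝ × Plane => c.1 • c.2) '' (Ici R ×ˢ Metric.sphere (0 : Plane) 1) := by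
    ext z
    simp only [mem_ofPred_eq, mem_image, mem_prod, mem_Ici, mem_sphere_zero_iff_norm, Prod.exists]
    constructor
    · intro hz
      have h0 : ‖z‖ ≠ 0 := by linarith
      refine ⟨‖z‖, ‖z‖⁻¹ • z, ⟨hz, ?_⟩, ?_⟩
      · rw [norm_smul, norm_inv, norm_norm, inv_mul_cancel₀ h0]
      · rw [smul_smul, mul_inv_cancel₀ h0, one_smul]
    · rintro ⟨a, b, ⟨ha, hb⟩, rfl⟩
      rw [norm_smul, hb, mul_one, Real.norm_eq_abs]
      exact ha.trans (le_abs_self a)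
  rw [h]
  exact (isPreconnected_Ici.prod (isPreconnected_sphere hrank 0 1)).image _ (by fun_prop)

theorem nonempty_setOf_le_norm (R : ℝ) : {z : Plane | R ≤ ‖z‖}.Nonempty :=
  NormedSpace.exists_lt_norm ℝ Plane R |>.imp fun _ h => le_of_lt h

theorem exists_isClosed_isPreconnected_between {E C : Set Plane} {R : ℝ} (hR : 0 < R)
    (hE : IsOpen E) (hEc : IsPreconnected E) (hRE : {z : Plane | R ≤ ‖z‖} ⊆ E)
    (hC : IsCompact C) (hCE : C ⊆ E) :
    ∃ Y, IsClosed Y ∧ IsPreconnected Y ∧ {z : Plane | R ≤ ‖z‖} ⊆ Y ∧ Y ⊆ E ∧ C ⊆ Y := by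
  obtain ⟨a, ha⟩ := nonempty_setOf_le_norm R
  have hclosed : IsClosed {z : Plane | R ≤ ‖z‖} := isClosed_le continuous_const continuous_norm
  have hconn := isPreconnected_setOf_le_norm hR
  refine hC.induction_on (p := fun C => ∃ Y, IsClosed Y ∧ IsPreconnected Y ∧
    {z : Plane | R ≤ ‖z‖} ⊆ Y ∧ Y ⊆ E ∧ C ⊆ Y) ?_ ?_ ?_ ?_
  · exact ⟨_, hclosed, hconn, Subset.rfl, hRE, empty_subset _⟩
  · rintro s t hst ⟨Y, h1, h2, h3, h4, h5⟩
    exact ⟨Y, h1, h2, h3, h4, hst.trans h5⟩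
  · rintro s t ⟨Y, h1, h2, h3, h4, h5⟩ ⟨Z, k1, k2, k3, k4, k5⟩
    exact ⟨Y ∪ Z, h1.union k1, h2.union a (h3 ha) (k3 ha) k2, h3.trans subset_union_left,
      union_subset h4 k4, union_subset_union h5 k5⟩
  · intro x hx
    obtain ⟨r, hr, hball⟩ := Metric.nhds_basis_closedBall.mem_iff.1 (hE.mem_nhds (hCE hx))
    have hpath : IsPathConnected E := hE.isConnected_iff_isPathConnected.1 ⟨⟨a, hRE ha⟩, hEc⟩
    obtain ⟨γ, hγ⟩ := hpath.joinedIn a (hRE ha) x (hCE hx)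
    have ha' : a ∈ range γ := ⟨0, γ.source⟩
    have hx' : x ∈ range γ := ⟨1, γ.target⟩
    refine ⟨Metric.closedBall x r, mem_nhdsWithin_of_mem_nhds (Metric.closedBall_mem_nhds x hr),
      {z : Plane | R ≤ ‖z‖} ∪ range γ ∪ Metric.closedBall x r,
      (hclosed.union (isCompact_range γ.continuous).isClosed).union Metric.isClosed_closedBall,
      ?_, subset_union_left.trans subset_union_left, ?_, subset_union_right⟩
    · exact (hconn.union a ha ha' (isPreconnected_range γ.continuous)).union x (Or.inr hx')
        (Metric.mem_closedBall_self hr.le) Metric.isPreconnected_closedBall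
    · refine union_subset (union_subset hRE ?_) hball
      rintro _ ⟨t, rfl⟩
      exact hγ t

theorem Disjoint.eventually_cthickening {s t : Set Plane} (h : Disjoint s t)
    (hs : IsCompact s) (ht : IsClosed t) :
    ∀ᶠ δ in nhdsWithin (0 : ℝ) (Ioi 0),
      Disjoint (Metric.cthickening δ s) (Metric.cthickening δ t) := by
  obtain ⟨δ, hδ, hd⟩ := h.exists_cthickenings hs ht
  filter_upwards [Ioc_mem_nhdsGT hδ] with ε hε
  exact hd.mono (Metric.cthickening_mono hε.2 _) (Metric.cthickening_mono hε.2 _)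

theorem not_separated_of_forall_not_separated {ι : Type*} [Finite ι] [Nonempty ι] {K : Set Plane}
    (hK : IsCompact K) (hKc : IsPreconnected Kᶜ) {F T : ι → Set Plane}
    (hF : ∀ i, IsCompact (F i)) (hFd : ∀ i j, i ≠ j → Disjoint (F i) (F j))
    (hT : ∀ i, IsCompact (T i)) (hTc : ∀ i, IsPreconnected (T i)) (hTK : ∀ i, T i ⊆ K)
    (hTF : ∀ i, Disjoint (F i) (T i)) {p q : Plane} (hp : ∀ i, p ∈ T i) (hq : ∀ i, q ∈ T i)
    {A B : Set Plane} (hA : IsOpen A) (hB : IsOpen B)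
    (hpA : p ∈ A) (hqB : q ∈ B) (hcover : K ⊆ A ∪ B ∪ ⋃ i, F i)
    (hAB : K ∩ (A ∩ B) ⊆ ⋃ i, F i) : False := by
  classical
  cases nonempty_fintype ι
  obtain ⟨i₀⟩ := ‹Nonempty ι›
  have hpK := hTK i₀ (hp i₀)
  have hqK := hTK i₀ (hq i₀)
  obtain ⟨δ, ⟨hδT, hδF⟩, hδ⟩ : ∃ δ : ℝ,
      ((∀ i, Disjoint (Metric.cthickening δ (F i)) (Metric.cthickening δ (T i))) ∧
        ∀ i j, i ≠ j → Disjoint (Metric.cthickening δ (F i)) (Metric.cthickening δ (F j))) ∧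
        δ ∈ Ioi (0 : ℝ) := by
    refine Filter.Eventually.exists (f := nhdsWithin (0 : ℝ) (Ioi 0))
      (.and (.and (Filter.eventually_all.2 fun i => ?_)
        (Filter.eventually_all.2 fun i => Filter.eventually_all.2 fun j => ?_))
        self_mem_nhdsWithin)
    · exact (hTF i).eventually_cthickening (hF i) (hT i).isClosed
    · by_cases hij : i = j
      · simp [hij]
      · filter_upwards [(hFd i j hij).eventually_cthickening (hF i) (hF j).isClosed] with δ h _
        exact h
  let G : Set Plane := ⋃ i, Metric.thickening δ (F i)
  have hGo : IsOpen G := isOpen_iUnion fun i => Metric.isOpen_thickening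
  have hFG : (⋃ i, F i) ⊆ G := iUnion_mono fun i => Metric.self_subset_thickening hδ _
  have hA' : IsCompact ((K \ G) \ B) := (hK.diff hGo).diff hB
  have hB' : IsCompact ((K \ G) \ A) := (hK.diff hGo).diff hA
  have hdisj : Disjoint ((K \ G) \ B) ((K \ G) \ A) := by
    refine disjoint_left.2 fun z hz hz' => ?_
    rcases hcover hz.1.1 with (h | h) | h
    exacts [hz'.2 h, hz.2 h, hz.1.2 (hFG h)]
  obtain ⟨U, V, hU, hV, hAU, hBV, hUV⟩ := SeparatedNhds.of_isCompact_isCompact hA' hB' hdisj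
  have hKO : K ⊆ U ∪ V ∪ G := by
    intro z hz
    by_cases hzG : z ∈ G
    · exact Or.inr hzG
    · by_cases hzB : z ∈ B
      · have : z ∉ A := fun hzA => hzG (hFG (hAB ⟨hz, hzA, hzB⟩))
        exact Or.inl (Or.inr (hBV ⟨⟨hz, hzG⟩, this⟩))
      · exact Or.inl (Or.inl (hAU ⟨⟨hz, hzG⟩, hzB⟩))
  obtain ⟨R, hR, hKR⟩ := hK.isBounded.exists_pos_norm_lt
  have hRK : {z : Plane | R ≤ ‖z‖} ⊆ Kᶜ := fun z hz hzK => absurd (hKR z hzK) (not_lt.2 hz)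
  have hO : IsOpen (U ∪ V ∪ G) := (hU.union hV).union hGo
  obtain ⟨Y, hYc, hYconn, hRY, hYK, hCY⟩ := exists_isClosed_isPreconnected_between hR
    hK.isClosed.isOpen_compl hKc hRK ((isCompact_closedBall (0 : Plane) R).diff hO)
    (fun z hz hzK => hz.2 (hKO hzK))
  have hYO : Yᶜ ⊆ U ∪ V ∪ G := by
    intro z hz
    by_contra h
    by_cases hzR : R ≤ ‖z‖
    · exact hz (hRY hzR)
    · exact hz (hCY ⟨by simpa using (not_le.1 hzR).le, h⟩)
  let C : ι → Set Plane := fun i => Metric.cthickening δ (F i)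
  have hC : ∀ i, IsClosed (C i) := fun i => Metric.isClosed_cthickening
  have hCT : ∀ i, Disjoint (C i) (T i) := fun i =>
    (hδT i).mono_right (Metric.self_subset_cthickening _)
  have hlog : ∀ i, HasLogOn (fun z => (planeToComplex z - planeToComplex p) /
      (planeToComplex z - planeToComplex q)) (Y ∪ C i) := by
    intro i
    refine hasLogOn_div_of_isPreconnected (hYc.union (hC i)) (hTc i) ?_ (hp i) (hq i)
    exact disjoint_union_right.2
      ⟨disjoint_left.2 fun z hz hzY => hYK hzY (hTK i hz), (hCT i).symm⟩
  have hfin : ∀ s : Finset ι, IsClosed (Y ∪ ⋃ i ∈ s, C i) := fun s =>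
    hYc.union (s.finite_toSet.isClosed_biUnion fun i _ => hC i)
  have hall : ∀ s : Finset ι, s.Nonempty → HasLogOn (fun z => (planeToComplex z -
      planeToComplex p) / (planeToComplex z - planeToComplex q)) (Y ∪ ⋃ i ∈ s, C i) := by
    intro s hs
    induction hs using Finset.Nonempty.cons_induction with
    | singleton i => simpa using hlog i
    | cons i s his _ ih =>
      have h1 : Y ∪ ⋃ j ∈ Finset.cons i s his, C j = (Y ∪ C i) ∪ (Y ∪ ⋃ j ∈ s, C j) := by
        ext z
        simp only [Finset.mem_cons, mem_union, mem_iUnion, exists_prop]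
        grind
      have h2 : (Y ∪ C i) ∩ (Y ∪ ⋃ j ∈ s, C j) = Y := by
        rw [← union_inter_distrib_left, union_eq_left]
        rintro z ⟨hz, hz'⟩
        obtain ⟨j, hj, hzj⟩ := mem_iUnion₂.1 hz'
        have hij : i ≠ j := fun h => his (h ▸ hj)
        exact absurd hzj (disjoint_left.1 (hδF i j hij) hz)
      rw [h1]
      exact (hlog i).union (hYc.union (hC i)) (hfin s) (h2.symm ▸ hYconn) ih
  have hX : IsClosed (Y ∪ ⋃ i, C i) := hYc.union (isClosed_iUnion_of_finite hC)
  have hGC : G ⊆ ⋃ i, C i := iUnion_mono fun i => Metric.thickening_subset_cthickening _ _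
  have hnotin : ∀ x, x ∈ K → (∀ i, x ∈ T i) → x ∉ Y ∪ ⋃ i, C i := by
    rintro x hxK hx (h | h)
    · exact hYK h hxK
    · obtain ⟨i, hi⟩ := mem_iUnion.1 h
      exact disjoint_left.1 (hCT i) hi (hx i)
  have hpX := hnotin p hpK hp
  have hqX := hnotin q hqK hq
  have hpB : p ∉ B := fun h => hpX (Or.inr (hGC (hFG (hAB ⟨hpK, hpA, h⟩))))
  have hqA : q ∉ A := fun h => hqX (Or.inr (hGC (hFG (hAB ⟨hqK, h, hqB⟩))))
  refine not_hasLogOn_div_of_separated hX hU hV hUV ?_ (R := R) (fun z hz => Or.inl (hRY hz))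
    (p := p) (q := q) ⟨hAU ⟨⟨hpK, fun h => hpX (Or.inr (hGC h))⟩, hpB⟩, hpX⟩
    ⟨hBV ⟨⟨hqK, fun h => hqX (Or.inr (hGC h))⟩, hqA⟩, hqX⟩ ?_
  · intro z hz
    exact (hYO fun h => hz (Or.inl h)).resolve_right fun h => hz (Or.inr (hGC h))
  · simpa using hall Finset.univ ⟨i₀, Finset.mem_univ i₀⟩

/-- A set is locally star-shaped if every point of it sees all nearby points of the set. -/
def LocallyStarShaped (S : Set Plane) : Prop :=
  ∀ x ∈ S, ∀ᶠ y in nhds x, y ∈ S → segment ℝ x y ⊆ S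

theorem LocallyStarShaped.diff {S F : Set Plane} (hS : LocallyStarShaped S) (hF : IsClosed F) :
    LocallyStarShaped (S \ F) := by
  intro x hx
  obtain ⟨r, hr, hball⟩ := Metric.isOpen_iff.1 hF.isOpen_compl x hx.2
  filter_upwards [hS x hx.1, Metric.ball_mem_nhds x hr] with y hy hyr hyS z hz
  exact ⟨hy hyS.1 hz, hball ((convex_ball x r).segment_subset (Metric.mem_ball_self hr) hyr hz)⟩

theorem LocallyStarShaped.joinedIn {S T : Set Plane} (hS : LocallyStarShaped S)
    (hT : IsPreconnected T) (hTS : T ⊆ S) {p q : Plane} (hp : p ∈ T) (hq : q ∈ T) :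
    JoinedIn S p q := by
  refine hT.induction₂ (JoinedIn S) ?_ (fun _ _ _ _ _ _ h h' => h.trans h')
    (fun _ _ _ _ h => h.symm) hp hq
  intro x hx
  filter_upwards [mem_nhdsWithin_of_mem_nhds (hS x (hTS hx)), self_mem_nhdsWithin] with y hy hyT
  exact JoinedIn.of_segment_subset (hy (hTS hyT))

theorem LocallyStarShaped.eventually_mem_connectedComponentIn {S : Set Plane}
    (hS : LocallyStarShaped S) {a x : Plane} (hx : x ∈ connectedComponentIn S a) :
    ∀ᶠ y in nhds x, y ∈ S → y ∈ connectedComponentIn S a := by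
  filter_upwards [hS x (connectedComponentIn_subset S a hx)] with y hy hyS
  rw [connectedComponentIn_eq hx]
  exact (convex_segment x y).isPreconnected.subset_connectedComponentIn (left_mem_segment ℝ x y)
    (hy hyS) (right_mem_segment ℝ x y)

theorem eventually_mem_segment_of_lineMap_mem (a b x : Plane) :
    ∀ᶠ y in nhds x, ∀ t ∈ Ioc (0 : ℝ) 1, AffineMap.lineMap x y t ∈ segment ℝ a b →
      y ∈ segment ℝ a b ∧ x ∈ segment ℝ a b := by
  by_cases hx : x ∈ segment ℝ a b
  · rcases eq_or_ne a b with rfl | hab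
    · refine Filter.Eventually.of_forall fun y t ht h => ⟨?_, hx⟩
      rw [segment_same, mem_singleton_iff] at *
      subst hx
      rw [AffineMap.lineMap_apply_module'] at h
      have : t • (y - x) = 0 := by simpa using h
      rw [smul_eq_zero, sub_eq_zero] at this
      exact this.resolve_left ht.1.ne'
    · have hx' := hx
      rw [segment_eq_image_lineMap] at hx'
      obtain ⟨s, ⟨hs0, hs1⟩, rfl⟩ := hx'
      have hpos : 0 < dist a b := dist_pos.2 hab
      have key : ∀ ε > (0 : ℝ), ∀ᶠ y in nhds (AffineMap.lineMap a b s : Plane),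
          ∀ c : ℝ, y = AffineMap.lineMap a b c → |c - s| < ε := by
        intro ε hε
        filter_upwards [Metric.ball_mem_nhds _ (mul_pos hε hpos)] with y hy c hc
        rw [hc, Metric.mem_ball, dist_lineMap_lineMap, Real.dist_eq] at hy
        exact lt_of_mul_lt_mul_right hy hpos.le
      have h0 : ∀ᶠ y in nhds (AffineMap.lineMap a b s : Plane), 0 < s →
          ∀ c : ℝ, y = AffineMap.lineMap a b c → |c - s| < s := by
        by_cases h : 0 < s
        · filter_upwards [key s h] with y hy _ using hy
        · simp [h]
      have h1 : ∀ᶠ y in nhds (AffineMap.lineMap a b s : Plane), s < 1 →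
          ∀ c : ℝ, y = AffineMap.lineMap a b c → |c - s| < 1 - s := by
        by_cases h : s < 1
        · filter_upwards [key (1 - s) (by linarith)] with y hy _ using hy
        · simp [h]
      filter_upwards [h0, h1] with y hy0 hy1 t ⟨ht0, ht1⟩ h
      refine ⟨?_, hx⟩
      rw [segment_eq_image_lineMap] at h ⊢
      obtain ⟨s', ⟨hs0', hs1'⟩, he⟩ := h
      have hyc : y = AffineMap.lineMap a b (s + (s' - s) / t) := by
        rw [AffineMap.lineMap_apply_module', AffineMap.lineMap_apply_module',
          AffineMap.lineMap_apply_module'] at he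
        rw [AffineMap.lineMap_apply_module']
        have h2 : t • y = t • ((s + (s' - s) / t) • (b - a) + a) := by
          have h3 : t * (s + (s' - s) / t) = t * s + (s' - s) := by field_simp
          rw [smul_add t, smul_smul, h3]
          linear_combination (norm := module) (-1 : ℝ) • he
        exact smul_right_injective _ ht0.ne' h2
      refine ⟨s + (s' - s) / t, ⟨?_, ?_⟩, hyc.symm⟩
      · rcases hs0.eq_or_lt with h | h
        · rw [← h]; simp only [sub_zero, zero_add]; positivity
        · have := abs_lt.1 (hy0 h _ hyc)
          linarith
      · rcases hs1.eq_or_lt with h | h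
        · have : (s' - s) / t ≤ 0 := div_nonpos_of_nonpos_of_nonneg (by linarith) ht0.le
          linarith
        · have := abs_lt.1 (hy1 h _ hyc)
          linarith
  · have hcl : IsClosed (segment ℝ a b) := by
      rw [← convexHull_pair]
      exact ((Set.toFinite {a, b}).isCompact_convexHull ℝ).isClosed
    obtain ⟨r, hr, hball⟩ := Metric.isOpen_iff.1 hcl.isOpen_compl x hx
    filter_upwards [Metric.ball_mem_nhds x hr] with y hy t ht h
    refine absurd h (hball ((convex_ball x r).segment_subset (Metric.mem_ball_self hr) hy ?_))
    rw [segment_eq_image_lineMap]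
    exact ⟨t, ⟨ht.1.le, ht.2⟩, rfl⟩

namespace SimplePolygon

theorem isCompact_boundary (P : SimplePolygon) : IsCompact P.boundary := by
  refine (Finset.range P.n).isCompact_biUnion fun i _ => ?_
  rw [← convexHull_pair]
  exact (Set.toFinite _).isCompact_convexHull ℝ

theorem eventually_mem_boundary (P : SimplePolygon) (x : Plane) :
    ∀ᶠ y in nhds x, ∀ t ∈ Ioc (0 : ℝ) 1, AffineMap.lineMap x y t ∈ P.boundary →
      y ∈ P.boundary ∧ segment ℝ x y ⊆ P.boundary := by
  have h : ∀ᶠ y in nhds x, ∀ i ∈ Finset.range P.n, ∀ t ∈ Ioc (0 : ℝ) 1,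
      AffineMap.lineMap x y t ∈ segment ℝ (P.vertex i) (P.vertex (i + 1)) →
      y ∈ segment ℝ (P.vertex i) (P.vertex (i + 1)) ∧
        x ∈ segment ℝ (P.vertex i) (P.vertex (i + 1)) :=
    (Filter.eventually_all_finset _).2 fun i _ => eventually_mem_segment_of_lineMap_mem _ _ x
  filter_upwards [h] with y hy t ht hb
  obtain ⟨i, hi, hz⟩ := mem_iUnion₂.1 hb
  obtain ⟨h1, h2⟩ := hy i hi t ht hz
  exact ⟨mem_iUnion₂.2 ⟨i, hi, h1⟩,
    ((convex_segment _ _).segment_subset h2 h1).trans fun z hz => mem_iUnion₂.2 ⟨i, hi, hz⟩⟩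

theorem locallyStarShaped_region (P : SimplePolygon) : LocallyStarShaped P.region := by
  intro x hx
  filter_upwards [P.eventually_mem_boundary x] with y hy hyP
  by_cases hyb : y ∈ P.boundary
  · exact (hy 1 ⟨one_pos, le_rfl⟩ (by simpa using hyb)).2.trans subset_union_left
  · have hyc := (hyP.resolve_left hyb).2
    let I : Set Plane := AffineMap.lineMap x y '' Ioc (0 : ℝ) 1
    have hIc : IsPreconnected I :=
      isPreconnected_Ioc.image _ AffineMap.lineMap_continuous.continuousOn
    have hyI : y ∈ I := ⟨1, ⟨one_pos, le_rfl⟩, AffineMap.lineMap_apply_one _ _⟩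
    have hIb : I ⊆ P.boundaryᶜ := by
      rintro _ ⟨t, ht, rfl⟩ h
      exact hyb (hy t ht h).1
    intro z hz
    rw [segment_eq_image_lineMap] at hz
    obtain ⟨t, ⟨ht0, ht1⟩, rfl⟩ := hz
    rcases ht0.eq_or_lt with rfl | ht0
    · simpa using hx
    · have hzI : AffineMap.lineMap x y t ∈ I := ⟨t, ⟨ht0, ht1⟩, rfl⟩
      refine Or.inr ⟨hIb hzI, ?_⟩
      rwa [← connectedComponentIn_eq (hIc.subset_connectedComponentIn hyI hIb hzI)]

theorem exists_boundary_norm_lt (P : SimplePolygon) :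
    ∃ R > 0, {z : Plane | R ≤ ‖z‖} ⊆ P.boundaryᶜ := by
  obtain ⟨R, hR, h⟩ := P.isCompact_boundary.isBounded.exists_pos_norm_lt
  exact ⟨R, hR, fun z hz hzb => absurd (h z hzb) (not_lt.2 hz)⟩

theorem notMem_region_iff (P : SimplePolygon) {R : ℝ} (hR : 0 < R)
    (h : {z : Plane | R ≤ ‖z‖} ⊆ P.boundaryᶜ) (x : Plane) :
    x ∉ P.region ↔ ∃ y, R ≤ ‖y‖ ∧ x ∈ connectedComponentIn P.boundaryᶜ y := by
  constructor
  · intro hx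
    have hxb : x ∉ P.boundary := fun hb => hx (Or.inl hb)
    have hxu : ¬ Bornology.IsBounded (connectedComponentIn P.boundaryᶜ x) :=
      fun hb => hx (Or.inr ⟨hxb, hb⟩)
    by_contra! hc
    refine hxu ((Metric.isBounded_ball (x := (0 : Plane)) (r := R)).subset fun y hy => ?_)
    by_contra hyR
    refine hc y (by simpa using hyR) ?_
    rw [← connectedComponentIn_eq hy]
    exact mem_connectedComponentIn hxb
  · rintro ⟨y, hy, hxy⟩ (hb | ⟨-, hb⟩)
    · exact connectedComponentIn_subset _ _ hxy hb
    · rw [← connectedComponentIn_eq hxy] at hb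
      have hsub := (isPreconnected_setOf_le_norm hR).subset_connectedComponentIn hy h
      obtain ⟨M, hM⟩ := (hb.subset hsub).exists_norm_le
      obtain ⟨z, hz⟩ := NormedSpace.exists_lt_norm ℝ Plane (max R M)
      exact absurd (hM z ((le_max_left _ _).trans hz.le))
        (not_le.2 ((le_max_right _ _).trans_lt hz))

theorem isClosed_region (P : SimplePolygon) : IsClosed P.region := by
  obtain ⟨R, hR, h⟩ := P.exists_boundary_norm_lt
  have : P.regionᶜ = ⋃ y ∈ {z : Plane | R ≤ ‖z‖}, connectedComponentIn P.boundaryᶜ y := by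
    ext x
    simpa using P.notMem_region_iff hR h x
  rw [← isOpen_compl_iff, this]
  exact isOpen_biUnion fun y _ => P.isCompact_boundary.isClosed.isOpen_compl.connectedComponentIn

theorem isCompact_region (P : SimplePolygon) : IsCompact P.region := by
  obtain ⟨R, hR, h⟩ := P.exists_boundary_norm_lt
  refine Metric.isCompact_of_isClosed_isBounded P.isClosed_region
    ((Metric.isBounded_ball (x := (0 : Plane)) (r := R)).subset fun x hx => ?_)
  by_contra hxR
  have hxR : R ≤ ‖x‖ := by simpa using hxR
  exact (P.notMem_region_iff hR h x).2 ⟨x, hxR, mem_connectedComponentIn (h hxR)⟩ hx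

theorem isPreconnected_compl_region (P : SimplePolygon) : IsPreconnected P.regionᶜ := by
  obtain ⟨R, hR, h⟩ := P.exists_boundary_norm_lt
  obtain ⟨a, ha⟩ := nonempty_setOf_le_norm R
  refine isPreconnected_of_forall a fun x hx => ?_
  obtain ⟨y, hy, hxy⟩ := (P.notMem_region_iff hR h x).1 hx
  refine ⟨connectedComponentIn P.boundaryᶜ y, ?_, ?_, hxy, isPreconnected_connectedComponentIn⟩
  · exact fun z hz => (P.notMem_region_iff hR h z).2 ⟨y, hy, hz⟩
  · exact (isPreconnected_setOf_le_norm hR).subset_connectedComponentIn hy h ha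

theorem Vis_subset_region (P : SimplePolygon) (p : Plane) : P.Vis p ⊆ P.region :=
  fun _ h => h.1

theorem isClosed_Vis (P : SimplePolygon) (p : Plane) : IsClosed (P.Vis p) := by
  have : P.Vis p = P.region ∩ ⋂ t ∈ Icc (0 : ℝ) 1, (fun q => AffineMap.lineMap p q t) ⁻¹'
      P.region := by
    ext q
    simp only [Vis, mem_ofPred_eq, segment_eq_image_lineMap, image_subset_iff, mem_inter_iff,
      mem_iInter, mem_preimage]
    rfl
  rw [this]
  refine P.isClosed_region.inter (isClosed_biInter fun t _ => P.isClosed_region.preimage ?_)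
  simp only [AffineMap.lineMap_apply_module]
  fun_prop

theorem isPreconnected_Vis (P : SimplePolygon) (p : Plane) : IsPreconnected (P.Vis p) := by
  refine isPreconnected_of_forall p fun q hq =>
    ⟨segment ℝ p q, fun z hz => ⟨hq.2 hz, ?_⟩, left_mem_segment ℝ p q, right_mem_segment ℝ p q,
      (convex_segment p q).isPreconnected⟩
  exact ((convex_segment p q).segment_subset (left_mem_segment ℝ p q) hz).trans hq.2

theorem self_mem_Vis (P : SimplePolygon) {p : Plane} (hp : p ∈ P.region) : p ∈ P.Vis p :=
  ⟨hp, by simpa using hp⟩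

theorem isClosed_biUnion_Vis (P : SimplePolygon) {W : Set Plane} (hW : W.Finite) :
    IsClosed (⋃ u ∈ W, P.Vis u) :=
  hW.isClosed_biUnion fun u _ => P.isClosed_Vis u

theorem exists_isCompOf_NVis_attached (P : SimplePolygon) {W : Set Plane} (hW : P.IsWitnessSet W)
    {v w : Plane} (hadj : P.GConAdj W v w) :
    ∃ NV, IsCompOf NV (P.NVis W) ∧ P.Attached NV v ∧ P.Attached NV w := by
  obtain ⟨hv, hw, hvw, γ, f, rfl, hf⟩ := hadj
  have hdisj := hW.2.2 v hv w hw hvw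
  have hfc : Continuous f.extend := f.continuous_extend
  have hfmem : ∀ t, f.extend t ∈ P.Vis v ∪ P.NVis W ∪ P.Vis w := fun t =>
    hf (by rw [← f.extend_range]; exact mem_range_self t)
  obtain ⟨b, ⟨⟨hb0, hb1⟩, hbw⟩, hbmin⟩ := ((isCompact_Icc (a := (0 : ℝ)) (b := 1)).inter_right
    ((P.isClosed_Vis w).preimage hfc)).exists_isLeast
    ⟨1, ⟨zero_le_one, le_rfl⟩, by simpa using P.self_mem_Vis (hW.2.1 hw)⟩
  obtain ⟨a, ⟨⟨ha0, hab⟩, hav⟩, hamax⟩ := ((isCompact_Icc (a := (0 : ℝ)) (b := b)).inter_right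
    ((P.isClosed_Vis v).preimage hfc)).exists_isGreatest
    ⟨0, ⟨le_rfl, hb0⟩, by simpa using P.self_mem_Vis (hW.2.1 hv)⟩
  have hlt : a < b := by
    refine lt_of_le_of_ne hab fun h => ?_
    subst h
    exact (hdisj ▸ (⟨hav, hbw⟩ : f.extend a ∈ P.Vis v ∩ P.Vis w) : f.extend a ∈ (∅ : Set Plane))
  have hsub : f.extend '' Ioo a b ⊆ P.NVis W := by
    rintro _ ⟨t, ⟨hat, htb⟩, rfl⟩
    rcases hfmem t with (h | h) | h
    · exact absurd (hamax ⟨⟨by linarith, htb.le⟩, h⟩) (not_le.2 hat)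
    · exact h
    · exact absurd (hbmin ⟨⟨by linarith, by linarith⟩, h⟩) (not_le.2 htb)
  obtain ⟨m, hm⟩ := nonempty_Ioo.2 hlt
  have hcomp : f.extend '' Ioo a b ⊆ connectedComponentIn (P.NVis W) (f.extend m) :=
    (isPreconnected_Ioo.image _ hfc.continuousOn).subset_connectedComponentIn
      (mem_image_of_mem _ hm) hsub
  have hcl : ∀ t ∈ Icc a b,
      f.extend t ∈ closure (connectedComponentIn (P.NVis W) (f.extend m)) := by
    intro t ht
    rw [← closure_Ioo hlt.ne] at ht
    exact closure_mono hcomp (image_closure_subset_closure_image hfc (mem_image_of_mem _ ht))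
  exact ⟨_, ⟨_, hsub (mem_image_of_mem _ hm), rfl⟩, ⟨_, hcl a ⟨le_rfl, hab⟩, hav⟩,
    ⟨_, hcl b ⟨hab, le_rfl⟩, hbw⟩⟩

/-- Two components attached to a common visibility region form a preconnected set with it. -/
theorem isPreconnected_union_Vis_union (P : SimplePolygon) {N₁ N₂ : Set Plane}
    (h₁ : IsPreconnected N₁) (h₂ : IsPreconnected N₂) {v : Plane} (ha₁ : P.Attached N₁ v)
    (ha₂ : P.Attached N₂ v) : IsPreconnected (N₁ ∪ P.Vis v ∪ N₂) := by
  obtain ⟨x₁, hx₁, hv₁⟩ := ha₁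
  obtain ⟨x₂, hx₂, hv₂⟩ := ha₂
  have k₁ : IsPreconnected (insert x₁ N₁) := h₁.subset_closure (subset_insert _ _)
    (insert_subset hx₁ subset_closure)
  have k₂ : IsPreconnected (insert x₂ N₂) := h₂.subset_closure (subset_insert _ _)
    (insert_subset hx₂ subset_closure)
  have : N₁ ∪ P.Vis v ∪ N₂ = insert x₁ N₁ ∪ P.Vis v ∪ insert x₂ N₂ := by
    ext z
    simp only [mem_union, mem_insert_iff]
    constructor
    · tauto
    · rintro (((rfl | h) | h) | (rfl | h)) <;> tauto
  rw [this]
  exact (k₁.union x₁ (mem_insert _ _) hv₁ (P.isPreconnected_Vis v)).union x₂ (Or.inr hv₂)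
    (mem_insert _ _) k₂

theorem isCompOf_NVis_attached_unique (P : SimplePolygon) {W : Set Plane}
    (hW : P.IsWitnessSet W) {v w : Plane} (hv : v ∈ W) (hw : w ∈ W) (hvw : v ≠ w)
    {N₁ N₂ : Set Plane} (h₁ : IsCompOf N₁ (P.NVis W)) (h₂ : IsCompOf N₂ (P.NVis W))
    (h₁v : P.Attached N₁ v) (h₁w : P.Attached N₁ w) (h₂v : P.Attached N₂ v)
    (h₂w : P.Attached N₂ w) : N₁ = N₂ := by
  by_contra hne
  obtain ⟨p, hp, rfl⟩ := h₁
  obtain ⟨q, hq, rfl⟩ := h₂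
  set S := P.NVis W with hS
  have hSl : LocallyStarShaped S :=
    P.locallyStarShaped_region.diff (P.isClosed_biUnion_Vis hW.1)
  have hpN : p ∈ connectedComponentIn S p := mem_connectedComponentIn hp
  have hqN : q ∈ connectedComponentIn S q := mem_connectedComponentIn hq
  have hN : ∀ u ∈ W, ∀ x, Disjoint (connectedComponentIn S x) (P.Vis u) := fun u hu x =>
    disjoint_left.2 fun z hz hzu => (connectedComponentIn_subset S x hz).2
      (mem_iUnion₂.2 ⟨u, hu, hzu⟩)
  have hT : ∀ u : W, ∃ T : Set Plane, IsPreconnected T ∧ T ⊆ P.region \ P.Vis u ∧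
      p ∈ T ∧ q ∈ T := by
    rintro ⟨u, hu⟩
    obtain ⟨z, hz, hzu, hz₁, hz₂⟩ : ∃ z ∈ W, z ≠ u ∧ P.Attached (connectedComponentIn S p) z ∧
        P.Attached (connectedComponentIn S q) z := by
      by_cases h : v = u
      · exact ⟨w, hw, fun h' => hvw (h.trans h'.symm), h₁w, h₂w⟩
      · exact ⟨v, hv, h, h₁v, h₂v⟩
    refine ⟨_, P.isPreconnected_union_Vis_union isPreconnected_connectedComponentIn
      isPreconnected_connectedComponentIn hz₁ hz₂, ?_, Or.inl (Or.inl hpN), Or.inr hqN⟩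
    have hcs : ∀ x, connectedComponentIn S x ⊆ P.region \ P.Vis u := fun x y hy =>
      ⟨(connectedComponentIn_subset S x hy).1, disjoint_left.1 (hN u hu x) hy⟩
    refine union_subset (union_subset (hcs p) fun y hy => ⟨hy.1, fun hyu => ?_⟩) (hcs q)
    exact (hW.2.2 z hz u hu hzu ▸ (⟨hy, hyu⟩ : y ∈ P.Vis z ∩ P.Vis u) : y ∈ (∅ : Set Plane))
  choose T hTc hTs hTp hTq using hT
  have hJ : ∀ u : W, JoinedIn (P.region \ P.Vis u) p q := fun u =>
    (P.locallyStarShaped_region.diff (P.isClosed_Vis u)).joinedIn (hTc u) (hTs u) (hTp u) (hTq u)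
  choose γ hγ using hJ
  have hγs : ∀ u, range (γ u) ⊆ P.region \ P.Vis u := fun u => range_subset_iff.2 (hγ u)
  have : Finite W := hW.1
  have : Nonempty W := ⟨⟨v, hv⟩⟩
  have hFS : (⋃ u : W, P.Vis u) = ⋃ u ∈ W, P.Vis u := (biUnion_eq_iUnion W fun u _ => P.Vis u).symm
  set N := connectedComponentIn S p with hNdef
  have hqn : q ∉ N := fun h => hne (connectedComponentIn_eq h)
  refine not_separated_of_forall_not_separated P.isCompact_region P.isPreconnected_compl_region
    (F := fun u : W => P.Vis u) (T := fun u => range (γ u))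
    (fun u => P.isCompact_region.of_isClosed_subset (P.isClosed_Vis u) (P.Vis_subset_region u))
    (fun u u' h => disjoint_iff_inter_eq_empty.2
      (hW.2.2 u u.2 u' u'.2 fun h' => h (Subtype.ext h')))
    (fun u => isCompact_range (γ u).continuous) (fun u => isPreconnected_range (γ u).continuous)
    (fun u => (hγs u).trans sdiff_subset)
    (fun u => disjoint_right.2 fun z hz => (hγs u hz).2)
    (p := p) (q := q) (fun u => ⟨0, (γ u).source⟩) (fun u => ⟨1, (γ u).target⟩)
    (A := interior {y | y ∈ S → y ∈ N}) (B := interior {y | y ∈ S → y ∉ N})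
    isOpen_interior isOpen_interior ?_ ?_ ?_ ?_
  · exact mem_interior_iff_mem_nhds.2 (hSl.eventually_mem_connectedComponentIn hpN)
  all_goals
    have hcl : ∀ x ∈ S, x ∉ N → x ∈ interior {y | y ∈ S → y ∉ N} := by
      intro x hx hxN
      refine mem_interior_iff_mem_nhds.2 ?_
      filter_upwards [hSl.eventually_mem_connectedComponentIn (mem_connectedComponentIn hx)]
        with y hy hyS hyN
      refine hxN ?_
      rw [hNdef, connectedComponentIn_eq hyN, ← connectedComponentIn_eq (hy hyS)]
      exact mem_connectedComponentIn hx
  · exact hcl q hq hqn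
  · intro z hz
    rw [hFS]
    by_cases hzF : z ∈ ⋃ u ∈ W, P.Vis u
    · exact Or.inr hzF
    · left
      have hzS : z ∈ S := ⟨hz, hzF⟩
      by_cases hzN : z ∈ N
      · exact Or.inl (mem_interior_iff_mem_nhds.2 (hSl.eventually_mem_connectedComponentIn hzN))
      · exact Or.inr (hcl z hzS hzN)
  · rintro z ⟨hz, hzA, hzB⟩
    rw [hFS]
    by_contra hzF
    have hzS : z ∈ S := ⟨hz, hzF⟩
    exact interior_subset hzB hzS (interior_subset hzA hzS)

end SimplePolygon

/-- Unique component between neighbor witnesses. -/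
theorem unique_component_between_neighbors (P : SimplePolygon) (W : Set Plane)
    (hW : P.IsWitnessSet W) (hreg : ∀ u ∈ W, P.VisRegular u)
    (v w : Plane) (hadj : P.GConAdj W v w) :
    ∃! NV : Set Plane, IsCompOf NV (P.NVis W) ∧ P.Attached NV v ∧ P.Attached NV w := by
  obtain ⟨NV, hNV, hv, hw⟩ := P.exists_isCompOf_NVis_attached hW hadj
  exact ⟨NV, ⟨hNV, hv, hw⟩, fun N hN => P.isCompOf_NVis_attached_unique hW hadj.1 hadj.2.1
    hadj.2.2.1 hN.1 hNV hN.2.1 hN.2.2 hv hw⟩
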